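/- Let F ⊂ ℝ² be an empty integral polygon and p a singular vertex of F (the primitive vectors along the two edges at p do not form a ℤ-basis of ℤ²). Then F is a t-triangle with t > 1, and p corresponds to the vertex (0,1) of conv{(0,0),(t,0),(0,1)} under a suitable integral affine isomorphism; equivalently, F is a triangle and the edge opposite p is not primitive. -/

import Mathlib

/-- A point of `ℝ²` is a lattice point if all its coordinates are integers. -/
def IsLatticePt (x : Fin 2 → ℝ) : Prop := ∀ i, ∃ m : ℤ, x i = (m : ℝ)

/-- The inclusion `ℤ² → ℝ²`. -/
def castPt (p : Fin 2 → ℤ) : Fin 2 → ℝ := fun i => (p i : ℝ)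

/-- `e` is the primitive integral direction of an edge of `F` emanating from the point `p`:
`e` is a primitive vector of `ℤ²` and a (short) segment from `p` in direction `e` lies in the
boundary of `F`. -/
def IsEdgeDirAt (F : Set (Fin 2 → ℝ)) (p : Fin 2 → ℝ) (e : Fin 2 → ℤ) : Prop :=
  Int.gcd (e 0) (e 1) = 1 ∧
  ∃ ε : ℝ, 0 < ε ∧ ∀ t : ℝ, 0 ≤ t → t ≤ ε → (p + t • castPt e) ∈ frontier F

/-- The determinant of two plane vectors. -/
def planeDet {R : Type*} [CommRing R] (x y : Fin 2 → R) : R := x 0 * y 1 - x 1 * y 0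

theorem planeDet_castPt (x y : Fin 2 → ℤ) :
    planeDet (castPt x) (castPt y) = ((planeDet x y : ℤ) : ℝ) := by
  simp [planeDet, castPt]

theorem castPt_sub (x y : Fin 2 → ℤ) : castPt (x - y) = castPt x - castPt y := by
  ext i; simp [castPt]

theorem castPt_add (x y : Fin 2 → ℤ) : castPt (x + y) = castPt x + castPt y := by
  ext i; simp [castPt]

theorem castPt_zsmul (n : ℤ) (x : Fin 2 → ℤ) : castPt (n • x) = (n : ℝ) • castPt x := by
  ext i; simp [castPt]

theorem castPt_injective : Function.Injective castPt := by
  intro x y h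
  ext i
  exact Int.cast_injective (congrFun h i)

theorem isLatticePt_castPt (x : Fin 2 → ℤ) : IsLatticePt (castPt x) := fun i => ⟨x i, rfl⟩

theorem IsLatticePt.exists_castPt {x : Fin 2 → ℝ} (h : IsLatticePt x) :
    ∃ y : Fin 2 → ℤ, castPt y = x := by
  choose y hy using h
  exact ⟨y, funext fun i => (hy i).symm⟩

theorem planeDet_pos_of_mem_interior {F : Set (Fin 2 → ℝ)} {u p x : Fin 2 → ℝ} (hu : u ≠ 0)
    (hF : ∀ y ∈ F, 0 ≤ planeDet u (y - p)) (hx : x ∈ interior F) :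
    0 < planeDet u (x - p) := by
  have hpos : 0 < u 0 * u 0 + u 1 * u 1 := by
    by_contra! h
    have h0 : u 0 = 0 := by nlinarith [mul_self_nonneg (u 0), mul_self_nonneg (u 1)]
    have h1 : u 1 = 0 := by nlinarith [mul_self_nonneg (u 0), mul_self_nonneg (u 1)]
    exact hu (by ext i; fin_cases i <;> simp [h0, h1])
  have hc : ContinuousAt (fun t : ℝ => x - t • ![-u 1, u 0]) 0 := by fun_prop
  have hev : ∀ᶠ t in nhds (0 : ℝ), x - t • ![-u 1, u 0] ∈ F := by
    apply hc.eventually_mem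
    simpa using mem_interior_iff_mem_nhds.1 hx
  obtain ⟨ε, hε, hball⟩ := Metric.eventually_nhds_iff.1 hev
  have h := hF _ (hball (y := ε / 2) (by
    rw [Real.dist_eq, sub_zero, abs_of_pos (by linarith)]; linarith))
  simp only [planeDet, Pi.sub_apply, Pi.smul_apply, smul_eq_mul, Matrix.cons_val_zero,
    Matrix.cons_val_one] at h ⊢
  nlinarith [mul_pos hε hpos]

theorem convex_setOf_planeDet_nonneg (u p : Fin 2 → ℝ) :
    Convex ℝ {y | 0 ≤ planeDet u (y - p)} := by
  intro x hx y hy a b ha hb hab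
  have h : planeDet u (a • x + b • y - p) =
      a * planeDet u (x - p) + b * planeDet u (y - p) := by
    simp only [planeDet, Pi.sub_apply, Pi.smul_apply, Pi.add_apply, smul_eq_mul]
    linear_combination (u 0 * p 1 - u 1 * p 0) * hab
  change 0 ≤ planeDet u (a • x + b • y - p)
  rw [h]
  exact add_nonneg (mul_nonneg ha hx) (mul_nonneg hb hy)

theorem planeDet_nonneg_of_mem_convexHull {S : Finset (Fin 2 → ℤ)} {u P : Fin 2 → ℤ}
    (h : ∀ s ∈ S, 0 ≤ planeDet u (s - P)) {x : Fin 2 → ℝ}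
    (hx : x ∈ convexHull ℝ (castPt '' (S : Set (Fin 2 → ℤ)))) :
    0 ≤ planeDet (castPt u) (x - castPt P) := by
  refine convexHull_min ?_ (convex_setOf_planeDet_nonneg (castPt u) (castPt P)) hx
  rintro _ ⟨s, hs, rfl⟩
  change 0 ≤ planeDet (castPt u) (castPt s - castPt P)
  rw [← castPt_sub, planeDet_castPt]
  exact_mod_cast h s hs

theorem Convex.add_smul_add_smul_mem {F : Set (Fin 2 → ℝ)} (hF : Convex ℝ F)
    {p u v : Fin 2 → ℝ} (hp : p ∈ F) (hu : p + u ∈ F) (hv : p + v ∈ F) {a b : ℝ}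
    (ha : 0 ≤ a) (hb : 0 ≤ b) (hab : a + b ≤ 1) : p + a • u + b • v ∈ F := by
  have h := hF.sum_mem (t := Finset.univ) (w := ![1 - a - b, a, b])
    (z := ![p, p + u, p + v])
    (by intro i _; fin_cases i <;> simp <;> linarith)
    (by simp [Fin.sum_univ_three]; ring)
    (by intro i _; fin_cases i <;> simp [hp, hu, hv])
  convert h using 1
  simp [Fin.sum_univ_three]
  module

/-- Cramer's rule in the plane. -/
theorem eq_add_smul_add_smul {u v : Fin 2 → ℝ} (h : planeDet u v ≠ 0) (p x : Fin 2 → ℝ) :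
    x = p + (planeDet (x - p) v / planeDet u v) • u
      + (planeDet u (x - p) / planeDet u v) • v := by
  have h' : ∀ i, (x - p) i * planeDet u v =
      planeDet (x - p) v * u i + planeDet u (x - p) * v i := by
    intro i
    fin_cases i <;> simp [planeDet] <;> ring
  ext i
  have := h' i
  simp only [Pi.add_apply, Pi.smul_apply, smul_eq_mul]
  rw [Pi.sub_apply] at this
  field_simp
  linarith

theorem Convex.add_smul_add_smul_mem_interior {F : Set (Fin 2 → ℝ)} (hF : Convex ℝ F)
    {p u v : Fin 2 → ℝ} (h : planeDet u v ≠ 0) (hp : p ∈ F) (hu : p + u ∈ F)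
    (hv : p + v ∈ F) {a b : ℝ} (ha : 0 < a) (hb : 0 < b) (hab : a + b < 1) :
    p + a • u + b • v ∈ interior F := by
  let f : (Fin 2 → ℝ) → ℝ := fun x => planeDet (x - p) v / planeDet u v
  let g : (Fin 2 → ℝ) → ℝ := fun x => planeDet u (x - p) / planeDet u v
  have hf : Continuous f := by simp only [f, planeDet]; fun_prop
  have hg : Continuous g := by simp only [g, planeDet]; fun_prop
  have ho : IsOpen {x | 0 < f x ∧ 0 < g x ∧ f x + g x < 1} :=
    (isOpen_lt continuous_const hf).inter
      ((isOpen_lt continuous_const hg).inter (isOpen_lt (hf.add hg) continuous_const))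
  refine interior_maximal ?_ ho ?_
  · rintro x ⟨h1, h2, h3⟩
    rw [eq_add_smul_add_smul h p x]
    exact hF.add_smul_add_smul_mem hp hu hv h1.le h2.le h3.le
  · have h1 : f (p + a • u + b • v) = a := by
      simp only [f]
      rw [div_eq_iff h]
      simp [planeDet]; ring
    have h2 : g (p + a • u + b • v) = b := by
      simp only [g]
      rw [div_eq_iff h]
      simp [planeDet]; ring
    simp only [Set.mem_ofPred_eq, h1, h2]
    exact ⟨ha, hb, hab⟩

/-- A point in the relative interior of the segment from `p + u` to `p + v` is interior to every
convex set containing `p`, `p + u`, `p + v` and a point beyond that segment. -/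
theorem Convex.mem_interior_of_exists_beyond {F : Set (Fin 2 → ℝ)} (hF : Convex ℝ F)
    {p u v : Fin 2 → ℝ} (h : planeDet u v ≠ 0) (hp : p ∈ F) (hu : p + u ∈ F)
    (hv : p + v ∈ F) {a b α β : ℝ} (ha : 0 < a) (hb : 0 < b) (hab : a + b = 1)
    (hα : 0 ≤ α) (hβ : 0 ≤ β) (hαβ : 1 < α + β) (hx : p + α • u + β • v ∈ F) :
    p + a • u + b • v ∈ interior F := by
  obtain ⟨c, hc, hc1, hca, hcb⟩ : ∃ c : ℝ, 0 < c ∧ c < 1 ∧ c * α < a ∧ c * β < b := by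
    have hs : 0 < α + β + 1 := by linarith
    refine ⟨min a b / (α + β + 1), div_pos (lt_min ha hb) hs, ?_, ?_, ?_⟩
    · rw [div_lt_one hs]
      exact (min_le_left a b).trans_lt (by linarith)
    · rw [div_mul_eq_mul_div, div_lt_iff₀ hs]
      have := lt_min ha hb
      nlinarith [min_le_left a b]
    · rw [div_mul_eq_mul_div, div_lt_iff₀ hs]
      have := lt_min ha hb
      nlinarith [min_le_right a b]
  have hc' : 0 < 1 - c := by linarith
  have hin := hF.add_smul_add_smul_mem_interior h hp hu hv
    (a := (a - c * α) / (1 - c)) (b := (b - c * β) / (1 - c))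
    (div_pos (by linarith) hc') (div_pos (by linarith) hc') (by
      rw [← add_div, div_lt_one hc']
      nlinarith)
  have hseg := hF.combo_interior_self_mem_interior hin hx hc' hc.le (by ring)
  convert hseg using 1
  ext i
  simp only [Pi.add_apply, Pi.smul_apply, smul_eq_mul]
  field_simp
  ring

/-- A nonzero integral vector is a positive multiple of a primitive one. -/
theorem exists_primitive_zsmul {x : Fin 2 → ℤ} (hx : x ≠ 0) :
    ∃ (n : ℤ) (e : Fin 2 → ℤ), 0 < n ∧ Int.gcd (e 0) (e 1) = 1 ∧ x = n • e := by
  have hg : 0 < Int.gcd (x 0) (x 1) := by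
    rw [Int.gcd_pos_iff]
    by_contra! h
    exact hx (by ext i; fin_cases i <;> simp [h])
  obtain ⟨a, b, hab, h0, h1⟩ := Int.exists_gcd_one hg
  refine ⟨Int.gcd (x 0) (x 1), ![a, b], by exact_mod_cast hg, by simpa using hab, ?_⟩
  ext i
  fin_cases i
  · simpa [mul_comm] using h0
  · simpa [mul_comm] using h1

theorem exists_pos_functional_of_extreme {S : Finset (Fin 2 → ℤ)} {P : Fin 2 → ℤ}
    (hP : castPt P ∈ (convexHull ℝ (castPt '' (S : Set (Fin 2 → ℤ)))).extremePoints ℝ) :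
    ∃ a b : ℝ, ∀ s ∈ S, s ≠ P → 0 < a * ((s - P) 0 : ℤ) + b * ((s - P) 1 : ℤ) := by
  have h := ((convex_convexHull ℝ _).mem_extremePoints_iff_mem_sdiff_convexHull_sdiff.1 hP).2
  have hsub : castPt '' (S.erase P : Set (Fin 2 → ℤ)) ⊆
      convexHull ℝ (castPt '' (S : Set (Fin 2 → ℤ))) \ {castPt P} := by
    rintro _ ⟨s, hs, rfl⟩
    simp only [Finset.mem_coe, Finset.mem_erase] at hs
    exact ⟨subset_convexHull ℝ _ ⟨s, hs.2, rfl⟩, fun h => hs.1 (castPt_injective h)⟩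
  have hP' : castPt P ∉ convexHull ℝ (castPt '' (S.erase P : Set (Fin 2 → ℤ))) :=
    fun hh => h (convexHull_mono hsub hh)
  obtain ⟨f, c, hfc, hf⟩ := geometric_hahn_banach_point_closed (convex_convexHull ℝ _)
    (((S.erase P).finite_toSet.image castPt).isClosed_convexHull ℝ) hP'
  have hrep : ∀ x : Fin 2 → ℝ, f x = f (Pi.single 0 1) * x 0 + f (Pi.single 1 1) * x 1 := by
    intro x
    have hx : x = x 0 • Pi.single 0 1 + x 1 • Pi.single 1 1 := by
      ext i; fin_cases i <;> simp
    conv_lhs => rw [hx]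
    simp only [map_add, map_smul, smul_eq_mul]
    ring
  refine ⟨f (Pi.single 0 1), f (Pi.single 1 1), fun s hs hne => ?_⟩
  have h1 := hf (castPt s) (subset_convexHull ℝ _ ⟨s, by simp [hs, hne], rfl⟩)
  rw [hrep] at h1 hfc
  simp only [castPt] at h1 hfc
  simp only [Pi.sub_apply]
  push_cast
  linarith

theorem planeDet_nonneg_of_div_le {a b : ℝ} {x y : Fin 2 → ℤ} (hx : 0 < a * x 0 + b * x 1)
    (hy : 0 < a * y 0 + b * y 1)
    (h : (a * x 1 - b * x 0) / (a * x 0 + b * x 1) ≤ (a * y 1 - b * y 0) / (a * y 0 + b * y 1)) :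
    0 ≤ planeDet x y := by
  rw [div_le_div_iff₀ hx hy] at h
  have hab : 0 < a * a + b * b := by
    by_contra! hn
    have ha : a = 0 := by nlinarith [mul_self_nonneg a, mul_self_nonneg b]
    have hb : b = 0 := by nlinarith [mul_self_nonneg a, mul_self_nonneg b]
    simp [ha, hb] at hx
  have h' : 0 ≤ (a * a + b * b) * (planeDet x y : ℤ) := by
    simp only [planeDet]
    push_cast
    linarith
  exact_mod_cast nonneg_of_mul_nonneg_right h' hab

/-- The two edge directions of a lattice polygon at a vertex, in counterclockwise order. -/
theorem exists_extreme_directions {S : Finset (Fin 2 → ℤ)} {P : Fin 2 → ℤ}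
    (hspan : affineSpan ℝ (convexHull ℝ (castPt '' (S : Set (Fin 2 → ℤ)))) = ⊤)
    (hP : castPt P ∈ (convexHull ℝ (castPt '' (S : Set (Fin 2 → ℤ)))).extremePoints ℝ) :
    ∃ u ∈ S, ∃ v ∈ S, (∀ s ∈ S, 0 ≤ planeDet (u - P) (s - P)) ∧
      (∀ s ∈ S, 0 ≤ planeDet (s - P) (v - P)) ∧ 0 < planeDet (u - P) (v - P) := by
  obtain ⟨a, b, hab⟩ := exists_pos_functional_of_extreme hP
  obtain ⟨x, hx⟩ := (convex_convexHull ℝ _).interior_nonempty_iff_affineSpan_eq_top.2 hspan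
  have hflat : ∀ e : Fin 2 → ℤ, e ≠ 0 → ¬ ∀ s ∈ S, planeDet e (s - P) = 0 := by
    intro e he hs
    have hcast : ∀ e : Fin 2 → ℤ, e ≠ 0 → castPt e ≠ 0 := fun e he h =>
      he (castPt_injective (h.trans (by ext; simp [castPt])))
    have h1 := planeDet_pos_of_mem_interior (hcast e he)
      (fun y hy => planeDet_nonneg_of_mem_convexHull (fun s h => (hs s h).ge) hy) hx
    have h2 := planeDet_pos_of_mem_interior (hcast (-e) (neg_ne_zero.2 he))
      (fun y hy => planeDet_nonneg_of_mem_convexHull (u := -e) (P := P) (fun s h => by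
        have := hs s h
        simp only [planeDet, Pi.neg_apply] at this ⊢
        linarith) hy) hx
    simp only [planeDet, castPt, Pi.neg_apply] at h1 h2
    push_cast at h2
    linarith
  have hne : (S.erase P).Nonempty := by
    by_contra hn
    rw [Finset.not_nonempty_iff_eq_empty] at hn
    refine hflat ![1, 0] (fun h => by simpa using congrFun h 0) fun s hs => ?_
    have : s = P := by
      by_contra hsP
      simpa [hn] using Finset.mem_erase.2 ⟨hsP, hs⟩
    simp [this, planeDet]
  let r : (Fin 2 → ℤ) → ℝ := fun s =>
    (a * ((s - P) 1 : ℤ) - b * ((s - P) 0 : ℤ)) / (a * ((s - P) 0 : ℤ) + b * ((s - P) 1 : ℤ))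
  obtain ⟨u, hu, hmin⟩ := (S.erase P).exists_min_image r hne
  obtain ⟨v, hv, hmax⟩ := (S.erase P).exists_max_image r hne
  rw [Finset.mem_erase] at hu hv
  have hu' : ∀ s ∈ S, 0 ≤ planeDet (u - P) (s - P) := by
    intro s hs
    by_cases hsP : s = P
    · simp [hsP, planeDet]
    · exact planeDet_nonneg_of_div_le (hab u hu.2 hu.1) (hab s hs hsP)
        (hmin s (Finset.mem_erase.2 ⟨hsP, hs⟩))
  have hv' : ∀ s ∈ S, 0 ≤ planeDet (s - P) (v - P) := by
    intro s hs
    by_cases hsP : s = P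
    · simp [hsP, planeDet]
    · exact planeDet_nonneg_of_div_le (hab s hs hsP) (hab v hv.2 hv.1)
        (hmax s (Finset.mem_erase.2 ⟨hsP, hs⟩))
  refine ⟨u, hu.2, v, hv.2, hu', hv', lt_of_le_of_ne (hu' v hv.2) fun h0 => ?_⟩
  refine hflat (u - P) (sub_ne_zero.2 hu.1) fun s hs => le_antisymm ?_ (hu' s hs)
  have h1 := hu' s hs
  have h2 := hv' s hs
  have hlu := hab u hu.2 hu.1
  have hlv := hab v hv.2 hv.1
  generalize u - P = x at *
  generalize v - P = y at *
  generalize s - P = z at *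
  have hid : (a * y 0 + b * y 1) * (planeDet x z : ℤ) + (a * x 0 + b * x 1) * (planeDet z y : ℤ)
      = (a * z 0 + b * z 1) * (planeDet x y : ℤ) := by
    simp only [planeDet]; push_cast; ring
  rw [← h0] at hid
  have h1' : (0 : ℝ) ≤ (planeDet x z : ℤ) := by exact_mod_cast h1
  have h2' : (0 : ℝ) ≤ (planeDet z y : ℤ) := by exact_mod_cast h2
  have h3 : ((planeDet x z : ℤ) : ℝ) ≤ 0 := by
    by_contra! hc
    have := mul_pos hlv hc
    have := mul_nonneg hlu.le h2'
    push_cast at hid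
    linarith
  exact_mod_cast h3

/-- A primitive vector `u` and a vector `v` with `0 < d = planeDet u v` have the form
`v = d • w - r • u`, where `u, w` is a lattice basis and `0 ≤ r < d`. -/
theorem exists_normal_form {u v : Fin 2 → ℤ} (hu : Int.gcd (u 0) (u 1) = 1)
    (hd : 0 < planeDet u v) :
    ∃ (w : Fin 2 → ℤ) (r : ℤ), planeDet u w = 1 ∧ 0 ≤ r ∧ r < planeDet u v ∧
      v = planeDet u v • w - r • u := by
  have hbez := Int.gcd_eq_gcd_ab (u 0) (u 1)
  rw [hu] at hbez
  set s := Int.gcdA (u 0) (u 1)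
  set t := Int.gcdB (u 0) (u 1)
  set d := planeDet u v with hdd
  set c := v 0 * s + v 1 * t with hc
  have hv0 : v 0 = c * u 0 - d * t := by
    simp only [hc, hdd, planeDet]; push_cast at hbez; linear_combination v 0 * hbez
  have hv1 : v 1 = c * u 1 + d * s := by
    simp only [hc, hdd, planeDet]; push_cast at hbez; linear_combination v 1 * hbez
  have hmod := Int.emod_add_mul_ediv (-c) d
  refine ⟨![-t, s] - ((-c) / d) • u, (-c) % d, ?_, Int.emod_nonneg _ hd.ne',
    Int.emod_lt_of_pos _ hd, ?_⟩
  · simp [planeDet]; push_cast at hbez; linear_combination -hbez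
  · ext i
    fin_cases i
    · simp only [Fin.zero_eta, Pi.sub_apply, Pi.smul_apply, smul_eq_mul, Matrix.cons_val_zero]
      linear_combination hv0 + u 0 * hmod
    · simp only [Fin.mk_one, Pi.sub_apply, Pi.smul_apply, smul_eq_mul, Matrix.cons_val_one,
        Matrix.cons_val_fin_one]
      linear_combination hv1 + u 1 * hmod

theorem isEdgeDirAt_of_planeDet_nonneg {F : Set (Fin 2 → ℝ)} (hF : Convex ℝ F)
    {p : Fin 2 → ℝ} {e : Fin 2 → ℤ} {u : Fin 2 → ℝ} (he : Int.gcd (e 0) (e 1) = 1)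
    (hp : p ∈ F) (hpe : p + castPt e ∈ F) (hu : u ≠ 0) (hue : planeDet u (castPt e) = 0)
    (hside : ∀ y ∈ F, 0 ≤ planeDet u (y - p)) : IsEdgeDirAt F p e := by
  refine ⟨he, 1, one_pos, fun t h0 h1 => ⟨subset_closure ?_, fun hint => ?_⟩⟩
  · simpa using hF.add_smul_add_smul_mem hp hpe hpe h0 le_rfl (by linarith)
  · have h := planeDet_pos_of_mem_interior hu hside hint
    have : planeDet u (p + t • castPt e - p) = t * planeDet u (castPt e) := by
      simp [planeDet]; ring
    rw [this, hue, mul_zero] at h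
    exact lt_irrefl _ h

/-- The affine isomorphism sending `p`, `p + u`, `p + w` to `(0,1)`, `(0,0)`, `(1,0)`, for a
lattice basis `u, w`. -/
theorem exists_lattice_affineEquiv (p u w : Fin 2 → ℤ) (h : planeDet u w = 1) :
    ∃ T : (Fin 2 → ℝ) ≃ᵃ[ℝ] (Fin 2 → ℝ), (∀ x, IsLatticePt x ↔ IsLatticePt (T x)) ∧
      ∀ α β : ℝ, T (castPt p + α • castPt u + β • castPt w) = ![β, 1 - α - β] := by
  have hR : (u 0 : ℝ) * w 1 - u 1 * w 0 = 1 := by exact_mod_cast h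
  let L : (Fin 2 → ℝ) ≃ₗ[ℝ] (Fin 2 → ℝ) :=
    { toFun := fun x => ![planeDet (castPt u) x,
        - planeDet x (castPt w) - planeDet (castPt u) x]
      map_add' := by
        intro x y; ext i; fin_cases i <;> simp [planeDet] <;> ring
      map_smul' := by
        intro c x; ext i; fin_cases i <;> simp [planeDet] <;> ring
      invFun := fun y => (- y 0 - y 1) • castPt u + y 0 • castPt w
      left_inv := by
        intro x; ext i
        fin_cases i <;> simp [planeDet, castPt]
        · linear_combination x 0 * hR
        · linear_combination x 1 * hR
      right_inv := by
        intro x; ext i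
        fin_cases i <;> simp [planeDet, castPt]
        · linear_combination x 0 * hR
        · linear_combination x 1 * hR }
  obtain ⟨T, hT⟩ : ∃ T : (Fin 2 → ℝ) ≃ᵃ[ℝ] (Fin 2 → ℝ),
      ∀ x, T x = L (x - castPt p) + ![0, 1] :=
    ⟨AffineEquiv.mk' (fun x => L (x - castPt p) + ![0, 1]) L (castPt p) (by intro x; simp),
      fun _ => rfl⟩
  have hform : ∀ α β : ℝ, T (castPt p + α • castPt u + β • castPt w) = ![β, 1 - α - β] := by
    intro α β
    ext i
    fin_cases i <;> simp [hT, L, planeDet, castPt]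
    · linear_combination β * hR
    · linear_combination (- α - β) * hR
  refine ⟨T, fun x => ⟨fun hx => ?_, fun hx => ?_⟩, hform⟩
  · obtain ⟨y, rfl⟩ := hx.exists_castPt
    convert isLatticePt_castPt
      ![planeDet u (y - p), 1 - planeDet (y - p) w - planeDet u (y - p)]
    ext i
    fin_cases i <;> simp [hT, L, planeDet, castPt]
    ring
  · obtain ⟨y, hy⟩ := hx.exists_castPt
    have : x = castPt (p + (1 - y 0 - y 1) • u + y 0 • w) := by
      apply T.injective
      rw [← hy, castPt_add, castPt_add, castPt_zsmul, castPt_zsmul, hform]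
      ext i
      fin_cases i <;> (simp [castPt]; try ring)
    rw [this]
    exact isLatticePt_castPt _

/-- If `p` is a *singular* vertex of an empty integral polygon `F` (the primitive vectors
along the two edges at `p` never form a `ℤ`-basis of `ℤ²`), then `F` is a `t`-triangle with
`t > 1` and, under a suitable lattice-preserving integral affine isomorphism bringing `F` to
`conv{(0,0),(t,0),(0,1)}`, the vertex `p` corresponds to `(0,1)` (so that the edge opposite
to `p` is not primitive). -/
theorem stmt7 (S : Finset (Fin 2 → ℤ)) (F : Set (Fin 2 → ℝ))
    (hF : F = convexHull ℝ (castPt '' (S : Set (Fin 2 → ℤ))))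
    (hspan : affineSpan ℝ F = ⊤)
    (hempty : ∀ x ∈ interior F, ¬ IsLatticePt x)
    (p : Fin 2 → ℝ)
    (hvert : p ∈ F.extremePoints ℝ)
    (hlat : IsLatticePt p)
    (hsing : ∀ e₁ e₂ : Fin 2 → ℤ, IsEdgeDirAt F p e₁ → IsEdgeDirAt F p e₂ →
      e₁ 0 * e₂ 1 - e₁ 1 * e₂ 0 ≠ 1 ∧ e₁ 0 * e₂ 1 - e₁ 1 * e₂ 0 ≠ -1) :
    ∃ T : (Fin 2 → ℝ) ≃ᵃ[ℝ] (Fin 2 → ℝ),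
      (∀ x, IsLatticePt x ↔ IsLatticePt (T x)) ∧
      ∃ t : ℕ, 1 < t ∧
        T '' F = convexHull ℝ {![(0:ℝ),0], ![(t:ℝ),0], ![0,1]} ∧
        T p = ![(0:ℝ),1] := by
  subst hF
  obtain ⟨P, rfl⟩ := hlat.exists_castPt
  set F := convexHull ℝ (castPt '' (S : Set (Fin 2 → ℤ))) with hF
  have hconv : Convex ℝ F := convex_convexHull ℝ _
  have hPF : castPt P ∈ F := hvert.1
  obtain ⟨u', hu'S, v', hv'S, hu', hv', hpos⟩ := exists_extreme_directions hspan hvert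
  obtain ⟨m, u, hm, hugcd, hmu⟩ := exists_primitive_zsmul (x := u' - P) (by
    intro h; rw [h] at hpos; simp [planeDet] at hpos)
  obtain ⟨n, v, hn, hvgcd, hnv⟩ := exists_primitive_zsmul (x := v' - P) (by
    intro h; rw [h] at hpos; simp [planeDet] at hpos)
  have hmem : ∀ (k : ℤ) (e s : Fin 2 → ℤ), 0 < k → s ∈ S → s - P = k • e →
      castPt P + castPt e ∈ F := by
    intro k e s hk hs he
    have hk' : (1 : ℝ) ≤ k := by exact_mod_cast hk
    have hsF : castPt P + (k : ℝ) • castPt e ∈ F := by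
      rw [← castPt_zsmul, ← castPt_add, ← he, add_sub_cancel]
      exact subset_convexHull ℝ _ ⟨s, hs, rfl⟩
    have h := hconv.add_smul_mem hPF hsF (t := (k : ℝ)⁻¹)
      ⟨inv_nonneg.2 (by linarith), inv_le_one_of_one_le₀ hk'⟩
    rwa [smul_smul, inv_mul_cancel₀ (by linarith : (k : ℝ) ≠ 0), one_smul] at h
  have huF := hmem m u u' hm hu'S hmu
  have hvF := hmem n v v' hn hv'S hnv
  have hd : 0 < planeDet u v := by
    have : planeDet (u' - P) (v' - P) = m * n * planeDet u v := by
      rw [hmu, hnv]; simp [planeDet]; ring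
    rw [this] at hpos
    exact pos_of_mul_pos_right hpos (mul_pos hm hn).le
  have hSu : ∀ s ∈ S, 0 ≤ planeDet u (s - P) := by
    intro s hs
    have h := hu' s hs
    have : planeDet (u' - P) (s - P) = m * planeDet u (s - P) := by
      rw [hmu]; simp [planeDet]; ring
    rw [this] at h
    exact nonneg_of_mul_nonneg_right h hm
  have hSv : ∀ s ∈ S, 0 ≤ planeDet (-v) (s - P) := by
    intro s hs
    have h := hv' s hs
    have : planeDet (s - P) (v' - P) = n * planeDet (-v) (s - P) := by
      rw [hnv]; simp [planeDet]; ring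
    rw [this] at h
    exact nonneg_of_mul_nonneg_right h hn
  have hFu : ∀ x ∈ F, 0 ≤ planeDet (castPt u) (x - castPt P) :=
    fun x hx => planeDet_nonneg_of_mem_convexHull hSu hx
  have hFv : ∀ x ∈ F, 0 ≤ planeDet (castPt (-v)) (x - castPt P) :=
    fun x hx => planeDet_nonneg_of_mem_convexHull hSv hx
  have hdR : 0 < planeDet (castPt u) (castPt v) := by
    rw [planeDet_castPt]; exact_mod_cast hd
  have hEu : IsEdgeDirAt F (castPt P) u :=
    isEdgeDirAt_of_planeDet_nonneg hconv hugcd hPF huF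
      (by intro h; simp [h, planeDet] at hdR) (by simp [planeDet]; ring) hFu
  have hEv : IsEdgeDirAt F (castPt P) v :=
    isEdgeDirAt_of_planeDet_nonneg hconv hvgcd hPF hvF
      (by
        intro h
        have h0 := congrFun h 0
        have h1 := congrFun h 1
        simp [castPt] at h0 h1
        simp [planeDet, castPt, h0, h1] at hdR)
      (by simp [planeDet, castPt]; ring) hFv
  have hd2 : 2 ≤ planeDet u v := by
    have := (hsing u v hEu hEv).1
    simp only [planeDet] at hd ⊢
    omega
  obtain ⟨w, r, huw, hr0, hrd, hvw⟩ := exists_normal_form hugcd hd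
  obtain ⟨d, hdd⟩ : ∃ d, planeDet u v = d := ⟨_, rfl⟩
  have hdr : planeDet (castPt u) (castPt v) = d := by rw [planeDet_castPt, hdd]
  rw [hdd] at hd2 hrd hvw
  have hd0 : (0 : ℝ) < d := by rw [← hdr]; exact hdR
  have hr1 : 1 ≤ r := by
    by_contra! h
    obtain rfl : r = 0 := by omega
    have h0 : d ∣ v 0 := ⟨w 0, by rw [hvw]; simp⟩
    have h1 : d ∣ v 1 := ⟨w 1, by rw [hvw]; simp⟩
    have := Int.dvd_coe_gcd h0 h1
    rw [hvgcd] at this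
    have := Int.le_of_dvd one_pos this
    omega
  have hwR : castPt w = ((r : ℝ) / d) • castPt u + ((1 : ℝ) / d) • castPt v := by
    rw [hvw, sub_eq_add_neg, ← neg_smul, castPt_add, castPt_zsmul, castPt_zsmul]
    ext i
    simp only [Pi.add_apply, Pi.smul_apply, smul_eq_mul]
    field_simp
    push_cast
    ring
  have hwlat : castPt P + ((r : ℝ) / d) • castPt u + ((1 : ℝ) / d) • castPt v ∉ interior F := by
    intro h
    refine hempty _ h ?_
    rw [add_assoc, ← hwR, ← castPt_add]
    exact isLatticePt_castPt _
  have hr1R : (1 : ℝ) ≤ r := by exact_mod_cast hr1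
  have hreq : r = d - 1 := by
    by_contra hne
    have hlt : (r : ℝ) + 1 < d := by
      have : r + 1 < d := by omega
      exact_mod_cast this
    exact hwlat (hconv.add_smul_add_smul_mem_interior hdR.ne' hPF huF hvF
      (div_pos (by linarith) hd0) (div_pos one_pos hd0)
      (by rw [← add_div, div_lt_one hd0]; exact hlt))
  have hle : ∀ x ∈ F, planeDet (x - castPt P) (castPt v) / planeDet (castPt u) (castPt v) +
      planeDet (castPt u) (x - castPt P) / planeDet (castPt u) (castPt v) ≤ 1 := by
    intro x hx
    by_contra! hlt
    refine hwlat (hconv.mem_interior_of_exists_beyond hdR.ne' hPF huF hvF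
      (div_pos (by linarith) hd0) (div_pos one_pos hd0) ?_ ?_ ?_ hlt ?_)
    · rw [← add_div, hreq]
      push_cast
      rw [sub_add_cancel, div_self hd0.ne']
    · refine div_nonneg ?_ hdR.le
      have := hFv x hx
      simp only [planeDet, castPt, Pi.neg_apply, Pi.sub_apply] at this ⊢
      push_cast at this
      linarith
    · exact div_nonneg (hFu x hx) hdR.le
    · rwa [← eq_add_smul_add_smul hdR.ne']
  have htri : F = convexHull ℝ {castPt P + castPt u, castPt P + castPt v, castPt P} := by
    apply Set.Subset.antisymm
    · intro x hx
      rw [eq_add_smul_add_smul hdR.ne' (castPt P) x]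
      refine (convex_convexHull ℝ _).add_smul_add_smul_mem (subset_convexHull ℝ _ (by simp))
        (subset_convexHull ℝ _ (by simp)) (subset_convexHull ℝ _ (by simp)) ?_ ?_ (hle x hx)
      · refine div_nonneg ?_ hdR.le
        have := hFv x hx
        simp only [planeDet, castPt, Pi.neg_apply, Pi.sub_apply] at this ⊢
        push_cast at this
        linarith
      · exact div_nonneg (hFu x hx) hdR.le
    · refine convexHull_min ?_ hconv
      rintro x (rfl | rfl | rfl) <;> assumption
  obtain ⟨T, hTlat, hT⟩ := exists_lattice_affineEquiv P u w huw
  have hTP : T (castPt P) = ![0, 1] := by simpa using hT 0 0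
  have hTu : T (castPt P + castPt u) = ![0, 0] := by simpa using hT 1 0
  have hTv : T (castPt P + castPt v) = ![(d : ℝ), 0] := by
    have h := hT (-r) d
    convert h using 2
    · rw [hvw, sub_eq_add_neg, ← neg_smul, castPt_add, castPt_zsmul, castPt_zsmul]
      push_cast
      module
    · rw [hreq]; push_cast; simp
  refine ⟨T, hTlat, d.toNat, by omega, ?_, hTP⟩
  have hcast : ((d.toNat : ℕ) : ℝ) = d := by
    exact_mod_cast Int.toNat_of_nonneg (by omega : 0 ≤ d)
  rw [htri, hcast]
  have := T.toAffineMap.image_convexHull {castPt P + castPt u, castPt P + castPt v, castPt P}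
  simp only [AffineEquiv.coe_toAffineMap] at this
  rw [this, Set.image_insert_eq, Set.image_pair, hTP, hTu, hTv]
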